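/- For every Young diagram λ, the normalized character on a 2-cycle equals the third free cumulant: Σ_2^λ = R_3^λ (i.e., the Kerov polynomial K_2 equals R_3). -/

import Mathlib

open scoped BigOperators

namespace AsympRep

/-- A fixed filling: the canonical bijection between `Fin μ.card` and the cells of `μ`. -/
noncomputable def fill (μ : YoungDiagram) : Fin μ.card ≃ {c // c ∈ μ.cells} :=
  (Fintype.equivFinOfCardEq (Fintype.card_coe _)).symm

/-- Row coordinate of the box occupied by `x` in the canonical filling. -/
noncomputable def rowOf (μ : YoungDiagram) (x : Fin μ.card) : ℕ := (fill μ x).1.1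

/-- Column coordinate of the box occupied by `x` in the canonical filling. -/
noncomputable def colOf (μ : YoungDiagram) (x : Fin μ.card) : ℕ := (fill μ x).1.2

/-- The Young symmetrizer `c_μ = a_μ * b_μ` in the group algebra `ℚ[S_n]`, `n = |μ|`,
where `a_μ` is the sum of the row-preserving permutations and `b_μ` is the signed sum
of the column-preserving permutations (for the canonical filling of `μ`). -/
noncomputable def youngSymmetrizer (μ : YoungDiagram) :
    MonoidAlgebra ℚ (Equiv.Perm (Fin μ.card)) :=
  (∑ g : Equiv.Perm (Fin μ.card),
      if ∀ x, rowOf μ (g x) = rowOf μ x then MonoidAlgebra.single g (1 : ℚ) else 0) *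
  (∑ g : Equiv.Perm (Fin μ.card),
      if ∀ x, colOf μ (g x) = colOf μ x
      then MonoidAlgebra.single g ((Equiv.Perm.sign g : ℤ) : ℚ) else 0)

/-- The Specht module: the left ideal `ℚ[S_n]·c_μ`, realizing the irreducible
representation `ρ^μ` of `S_n` (by left multiplication). -/
noncomputable def spechtModule (μ : YoungDiagram) :
    Submodule ℚ (MonoidAlgebra ℚ (Equiv.Perm (Fin μ.card))) :=
  LinearMap.range (LinearMap.mulRight ℚ (youngSymmetrizer μ))

theorem spechtModule_invariant (μ : YoungDiagram) (π : Equiv.Perm (Fin μ.card)) :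
    ∀ x ∈ spechtModule μ,
      (LinearMap.mulLeft ℚ (MonoidAlgebra.single π (1 : ℚ))) x ∈ spechtModule μ := by
  rintro x ⟨y, rfl⟩
  exact ⟨MonoidAlgebra.single π (1 : ℚ) * y, by
    simp only [LinearMap.mulRight_apply, LinearMap.mulLeft_apply, mul_assoc]⟩

/-- The irreducible character `χ^μ(π) = Tr ρ^μ(π)` of the symmetric group `S_n`,
`n = |μ|`, computed as the trace of left multiplication by `π` on the Specht module. -/
noncomputable def irrChar (μ : YoungDiagram) (π : Equiv.Perm (Fin μ.card)) : ℚ :=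
  LinearMap.trace ℚ (spechtModule μ)
    ((LinearMap.mulLeft ℚ (MonoidAlgebra.single π (1 : ℚ))).restrict
      (spechtModule_invariant μ π))

/-- The normalized character
`Σ_π^μ = n(n-1)⋯(n-k+1) · Tr ρ^μ(π) / Tr ρ^μ(e)` for `π ∈ S_k`, where `π` is regarded
as a permutation of `{1,…,n}` acting as the identity on `{k+1,…,n}`; it is `0` if `k > n`. -/
noncomputable def normChar {k : ℕ} (μ : YoungDiagram) (π : Equiv.Perm (Fin k)) : ℚ :=
  if h : k ≤ μ.card then
    (μ.card.descFactorial k : ℚ)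
      * irrChar μ (π.viaEmbedding (Fin.castLEEmb h)) / irrChar μ 1
  else 0

/-- `Σ_m^μ`: the normalized character on the `m`-cycle `(1,2,…,m) ∈ S_m`. -/
noncomputable def SigmaCycle (μ : YoungDiagram) (m : ℕ) : ℚ := normChar μ (finRotate m)

/-- The dilation `sμ` of a Young diagram: every box is replaced by an `s × s` grid
of boxes. -/
def dilate (μ : YoungDiagram) (s : ℕ) : YoungDiagram where
  cells := (Finset.range (s * μ.colLen 0) ×ˢ Finset.range (s * μ.rowLen 0)).filter
      (fun c => (c.1 / s, c.2 / s) ∈ μ.cells)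
  isLowerSet := by
    intro a b hba h
    simp only [Finset.coe_filter, Set.mem_setOf_eq, Finset.mem_product,
      Finset.mem_range] at h ⊢
    exact ⟨⟨lt_of_le_of_lt hba.1 h.1.1, lt_of_le_of_lt hba.2 h.1.2⟩,
      μ.isLowerSet (Prod.mk_le_mk.mpr
        ⟨Nat.div_le_div_right hba.1, Nat.div_le_div_right hba.2⟩) h.2⟩

open scoped Classical in
/-- The `k`-th free cumulant `R_k^μ`: the coefficient of `s^k` in the polynomial
`s ↦ Σ_{k-1}^{sμ}`. -/
noncomputable def freeCumulant (μ : YoungDiagram) (k : ℕ) : ℚ :=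
  if h : ∃ p : Polynomial ℚ, ∀ s : ℕ, 0 < s →
      SigmaCycle (dilate μ s) (k - 1) = Polynomial.eval (s : ℚ) p
  then h.choose.coeff k else 0

/-- `N^μ(σ₁,σ₂)`: the number of colorings of the cycles of `σ₁` (by column numbers)
and of the cycles of `σ₂` (by row numbers) compatible with `μ`.  A coloring of the
cycles is encoded as a pair of functions on points constant on the respective cycles;
compatibility means that for every point `a` the box in column `h₁(a)` and row `h₂(a)`
belongs to `μ` (two cycles intersect precisely when they share a point). -/
noncomputable def Ncolorings {k : ℕ} (μ : YoungDiagram) (σ₁ σ₂ : Equiv.Perm (Fin k)) : ℕ :=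
  Set.ncard {h : (Fin k → ℕ) × (Fin k → ℕ) |
    (∀ a, h.1 (σ₁ a) = h.1 a) ∧ (∀ a, h.2 (σ₂ a) = h.2 a) ∧
    ∀ a, (h.2 a, h.1 a) ∈ μ.cells }

/-- `|C(σ)|`: the number of cycles of a permutation (fixed points count as cycles),
i.e. the number of orbits. -/
noncomputable def numCycles {k : ℕ} (σ : Equiv.Perm (Fin k)) : ℕ :=
  Set.ncard {s : Set (Fin k) | ∃ a, s = {b | σ.SameCycle a b}}

/-- The region of the plane occupied by the Young diagram `μ` drawn in the French
convention (row `i` of the diagram, `0`-indexed, occupies `[0, μ_i] × [i, i+1]`). -/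
def frenchRegion (μ : YoungDiagram) : Set (ℝ × ℝ) :=
  {p | 0 ≤ p.1 ∧ 0 ≤ p.2 ∧ p.1 ≤ (μ.rowLen ⌊p.2⌋.toNat : ℝ)}

/-- The parameter `S_i^μ = (i-1) ∬_{(x,y)∈μ} (x-y)^{i-2} dx dy` (French convention). -/
noncomputable def Sparam (μ : YoungDiagram) (i : ℕ) : ℝ :=
  ((i : ℝ) - 1) * ∫ p in frenchRegion μ, (p.1 - p.2) ^ (i - 2)

/-- The profile `ω : ℝ → ℝ` of a Young diagram: the boundary of the diagram drawn in
the Russian convention, i.e. the image of the French region under the rotation by `π/4`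
composed with the dilation by `√2`, `(x, y) ↦ (x - y, x + y)`.  `ω(u)` is the largest
`v` with `(u,v)` in the rotated region, and `ω(u) = |u|` away from the diagram. -/
noncomputable def profile (μ : YoungDiagram) (u : ℝ) : ℝ :=
  max |u| (sSup {v : ℝ | ((u + v) / 2, (v - u) / 2) ∈ frenchRegion μ})

open Equiv MonoidAlgebra

/-- The row symmetrizer of the canonical filling. -/
noncomputable def rowSymmetrizer (μ : YoungDiagram) : MonoidAlgebra ℚ (Perm (Fin μ.card)) :=
  ∑ g : Perm (Fin μ.card),
    if ∀ x, rowOf μ (g x) = rowOf μ x then MonoidAlgebra.single g (1 : ℚ) else 0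

/-- The column antisymmetrizer of the canonical filling. -/
noncomputable def colAntisymmetrizer (μ : YoungDiagram) : MonoidAlgebra ℚ (Perm (Fin μ.card)) :=
  ∑ g : Perm (Fin μ.card),
    if ∀ x, colOf μ (g x) = colOf μ x
    then MonoidAlgebra.single g ((Perm.sign g : ℤ) : ℚ) else 0

theorem youngSymmetrizer_eq (μ : YoungDiagram) :
    youngSymmetrizer μ = rowSymmetrizer μ * colAntisymmetrizer μ := rfl

theorem apply_swap_eq {α β : Type*} [DecidableEq α] (f : α → β) {x y : α} (h : f x = f y) (z : α) :
    f (swap x y z) = f z := by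
  rw [swap_apply_def]
  split_ifs with h1 h2
  · rw [h1, h]
  · rw [h2, h]
  · rfl

theorem rowSymmetrizer_mul_swap (μ : YoungDiagram) {x y : Fin μ.card}
    (h : rowOf μ x = rowOf μ y) :
    rowSymmetrizer μ * single (swap x y) 1 = rowSymmetrizer μ := by
  unfold rowSymmetrizer
  rw [Finset.sum_mul]
  refine Fintype.sum_equiv (Equiv.mulRight (swap x y)) _ _ fun g => ?_
  have key : (∀ z, rowOf μ ((g * swap x y) z) = rowOf μ z) ↔
      ∀ z, rowOf μ (g z) = rowOf μ z := by
    constructor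
    · intro hg z
      have := hg (swap x y z)
      rwa [Perm.mul_apply, swap_apply_self, apply_swap_eq _ h] at this
    · intro hg z
      rw [Perm.mul_apply, hg, apply_swap_eq _ h]
  simp only [Equiv.coe_mulRight, key, ite_mul, zero_mul, single_mul_single, mul_one]

theorem swap_mul_colAntisymmetrizer (μ : YoungDiagram) {x y : Fin μ.card} (hxy : x ≠ y)
    (h : colOf μ x = colOf μ y) :
    single (swap x y) 1 * colAntisymmetrizer μ = -colAntisymmetrizer μ := by
  unfold colAntisymmetrizer
  rw [Finset.mul_sum, ← Finset.sum_neg_distrib]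
  refine Fintype.sum_equiv (Equiv.mulLeft (swap x y)) _ _ fun g => ?_
  have key : (∀ z, colOf μ ((swap x y * g) z) = colOf μ z) ↔
      ∀ z, colOf μ (g z) = colOf μ z := by
    simp only [Perm.mul_apply, apply_swap_eq _ h]
  simp only [Equiv.coe_mulLeft, key, mul_ite, mul_zero, single_mul_single, one_mul,
    Perm.sign_mul, Perm.sign_swap hxy]
  split_ifs <;> simp [← single_neg]

theorem swap_eq_conj {α : Type*} [DecidableEq α] {x y z : α} (hxy : x ≠ y) (hyz : y ≠ z) :
    swap x y = swap x z * swap z y * swap x z := by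
  rw [swap_comm x y, swap_comm z y, swap_comm x z, swap_mul_swap_mul_swap hyz hxy.symm,
    swap_comm]

/-- If a box `z` lies in the row of `x` and in the column of `y`, then the transposition
`(x y)` is annihilated between the two symmetrizers. -/
theorem row_mul_swap_mul_col_of_corner (μ : YoungDiagram) {x y z : Fin μ.card}
    (hxy : x ≠ y) (hxz : x ≠ z) (hyz : y ≠ z)
    (hr : rowOf μ x = rowOf μ z) (hc : colOf μ z = colOf μ y) :
    rowSymmetrizer μ * single (swap x y) 1 * colAntisymmetrizer μ = 0 := by
  have h1 : rowSymmetrizer μ * single (swap x y) 1 * colAntisymmetrizer μ =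
      rowSymmetrizer μ * single (swap z y * swap x z) 1 * colAntisymmetrizer μ := by
    have : (single (swap x y) (1 : ℚ)) =
        single (swap x z) 1 * single (swap z y * swap x z) 1 := by
      rw [single_mul_single, one_mul, ← mul_assoc, ← swap_eq_conj hxy hyz]
    rw [this, ← mul_assoc, rowSymmetrizer_mul_swap μ hr]
  have h2 : rowSymmetrizer μ * single (swap x y) 1 * colAntisymmetrizer μ =
      -(rowSymmetrizer μ * single (swap z y * swap x z) 1 * colAntisymmetrizer μ) := by
    have : (single (swap x y) (1 : ℚ)) =
        single (swap z y * swap x z) 1 * single (swap z y) 1 := by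
      rw [single_mul_single, one_mul, swap_comm x y, swap_comm z y, swap_comm x z,
        ← swap_eq_conj hxy.symm hxz]
    rw [this, ← mul_assoc, mul_assoc _ (single (swap z y) 1),
      swap_mul_colAntisymmetrizer μ hyz.symm hc, mul_neg]
  rw [← h1, eq_neg_iff_add_eq_zero, ← two_smul ℚ] at h2
  exact (smul_eq_zero.mp h2).resolve_left two_ne_zero

theorem eq_of_rowOf_colOf (μ : YoungDiagram) {x y : Fin μ.card}
    (hr : rowOf μ x = rowOf μ y) (hc : colOf μ x = colOf μ y) : x = y :=
  (fill μ).injective (Subtype.ext (Prod.ext hr hc))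

theorem exists_rowOf_colOf (μ : YoungDiagram) {i j : ℕ} (h : (i, j) ∈ μ.cells) :
    ∃ z, rowOf μ z = i ∧ colOf μ z = j :=
  ⟨(fill μ).symm ⟨(i, j), h⟩, by simp [rowOf], by simp [colOf]⟩

/-- The scalar by which a transposition acts when squeezed between the two symmetrizers. -/
noncomputable def swapSign (μ : YoungDiagram) (x y : Fin μ.card) : ℚ :=
  (if rowOf μ x = rowOf μ y then 1 else 0) - (if colOf μ x = colOf μ y then 1 else 0)

theorem row_mul_swap_mul_col (μ : YoungDiagram) {x y : Fin μ.card} (hxy : x ≠ y) :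
    rowSymmetrizer μ * single (swap x y) 1 * colAntisymmetrizer μ =
      swapSign μ x y • youngSymmetrizer μ := by
  unfold swapSign
  rw [youngSymmetrizer_eq]
  by_cases hr : rowOf μ x = rowOf μ y
  · have hc : colOf μ x ≠ colOf μ y := fun hc => hxy (eq_of_rowOf_colOf μ hr hc)
    simp [hr, hc, rowSymmetrizer_mul_swap]
  by_cases hc : colOf μ x = colOf μ y
  · simp [hr, hc, mul_assoc, swap_mul_colAntisymmetrizer μ hxy hc]
  simp only [hr, hc, if_false, sub_self, zero_smul]
  wlog hlt : rowOf μ x < rowOf μ y generalizing x y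
  · rw [swap_comm]
    exact this hxy.symm (Ne.symm hr) (Ne.symm hc) (lt_of_le_of_ne (not_lt.mp hlt) (Ne.symm hr))
  have hy : (rowOf μ y, colOf μ y) ∈ μ.cells := (fill μ y).2
  obtain ⟨z, hz1, hz2⟩ := exists_rowOf_colOf μ (i := rowOf μ x) (j := colOf μ y)
    (μ.isLowerSet (Prod.mk_le_mk.mpr ⟨hlt.le, le_rfl⟩) hy)
  refine row_mul_swap_mul_col_of_corner μ hxy ?_ ?_ hz1.symm hz2
  · rintro rfl; exact hc hz2
  · rintro rfl; exact hr hz1.symm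

/-- Twice the sum of all transpositions in the group algebra. -/
noncomputable def transpositionSum (n : ℕ) : MonoidAlgebra ℚ (Perm (Fin n)) :=
  ∑ p ∈ (Finset.univ : Finset (Fin n)).offDiag, single (swap p.1 p.2) 1

theorem single_mul_transpositionSum {n : ℕ} (g : Perm (Fin n)) :
    single g (1 : ℚ) * transpositionSum n = transpositionSum n * single g 1 := by
  unfold transpositionSum
  rw [Finset.mul_sum, Finset.sum_mul]
  refine Finset.sum_equiv (Equiv.prodCongr g g) (by simp) fun p _ => ?_
  simp [single_mul_single, mul_swap_eq_swap_mul]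

theorem commute_transpositionSum {n : ℕ} (x : MonoidAlgebra ℚ (Perm (Fin n))) :
    x * transpositionSum n = transpositionSum n * x := by
  induction x using MonoidAlgebra.induction_on with
  | of g => exact single_mul_transpositionSum g
  | add x y hx hy => rw [add_mul, mul_add, hx, hy]
  | smul r x hx => rw [smul_mul_assoc, mul_smul_comm, hx]

/-- Twice the sum of the contents of `μ`, written as the number of ordered pairs of boxes in a
common row minus the number of ordered pairs of boxes in a common column. -/
noncomputable def doubleContent (μ : YoungDiagram) : ℚ :=
  ∑ c ∈ μ.cells, ∑ d ∈ μ.cells, ((if c.1 = d.1 then 1 else 0) - (if c.2 = d.2 then 1 else 0))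

theorem sum_fill (μ : YoungDiagram) (f : ℕ × ℕ → ℚ) :
    ∑ x, f (fill μ x).1 = ∑ c ∈ μ.cells, f c := by
  rw [← Finset.sum_coe_sort μ.cells f]
  exact Fintype.sum_equiv (fill μ) _ _ fun _ => rfl

theorem sum_swapSign (μ : YoungDiagram) :
    ∑ p ∈ (Finset.univ : Finset (Fin μ.card)).offDiag, swapSign μ p.1 p.2 = doubleContent μ := by
  have h : ∑ p : Fin μ.card × Fin μ.card, swapSign μ p.1 p.2 = doubleContent μ := by
    rw [Fintype.sum_prod_type, doubleContent, ← sum_fill]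
    refine Finset.sum_congr rfl fun x _ => ?_
    rw [← sum_fill]
    rfl
  rw [← h]
  refine Finset.sum_subset (Finset.subset_univ _) fun p _ hp => ?_
  have : p.1 = p.2 := by simpa using hp
  simp [swapSign, this]

theorem transpositionSum_mul_youngSymmetrizer (μ : YoungDiagram) :
    transpositionSum μ.card * youngSymmetrizer μ = doubleContent μ • youngSymmetrizer μ := by
  rw [← sum_swapSign, Finset.sum_smul]
  rw [youngSymmetrizer_eq, ← mul_assoc, ← commute_transpositionSum, ← youngSymmetrizer_eq,
    transpositionSum, Finset.mul_sum, Finset.sum_mul]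
  refine Finset.sum_congr rfl fun p hp => row_mul_swap_mul_col μ ?_
  simpa using hp

theorem youngSymmetrizer_coeff_one (μ : YoungDiagram) : (youngSymmetrizer μ).coeff 1 = 1 := by
  have hterm : ∀ g : Perm (Fin μ.card),
      (∑ h : Perm (Fin μ.card), (if ∀ x, rowOf μ (g x) = rowOf μ x then single g (1 : ℚ) else 0) *
        (if ∀ x, colOf μ (h x) = colOf μ x
          then single h ((Perm.sign h : ℤ) : ℚ) else 0)).coeff 1 = if g = 1 then 1 else 0 := by
    intro g
    rw [← Finset.mul_sum]
    split_ifs with h1 h2 h2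
    · subst h2
      rw [coeff_single_mul_apply, coeff_sum, Finset.sum_apply']
      rw [Finset.sum_eq_single 1]
      · simp
      · intro b _ hb
        split_ifs <;> simp [hb]
      · simp
    · rw [coeff_single_mul_apply, coeff_sum, Finset.sum_apply', one_mul]
      refine Finset.sum_eq_zero fun b _ => ?_
      split_ifs with h3
      · by_cases hb : b = g⁻¹ * 1
        · exfalso
          refine h2 (Equiv.ext fun x => eq_of_rowOf_colOf μ (h1 x) ?_)
          rw [← h3 (g x)]
          simp [hb]
        · rw [coeff_single, Finsupp.single_eq_of_ne (Ne.symm hb)]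
      · simp
    · subst h2; simp at h1
    · simp
  rw [youngSymmetrizer, Finset.sum_mul_sum, coeff_sum, Finset.sum_apply',
    Finset.sum_congr rfl fun g _ => hterm g]
  simp

/-- The action of a permutation on the Specht module. -/
noncomputable def spechtAction (μ : YoungDiagram) (π : Perm (Fin μ.card)) :
    Module.End ℚ (spechtModule μ) :=
  (LinearMap.mulLeft ℚ (single π (1 : ℚ))).restrict (spechtModule_invariant μ π)

theorem irrChar_eq (μ : YoungDiagram) (π : Perm (Fin μ.card)) :
    irrChar μ π = LinearMap.trace ℚ _ (spechtAction μ π) := rfl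

theorem spechtAction_mul (μ : YoungDiagram) (π σ : Perm (Fin μ.card)) :
    spechtAction μ (π * σ) = spechtAction μ π * spechtAction μ σ := by
  ext1 x
  apply Subtype.ext
  simp [spechtAction, LinearMap.restrict_apply, ← mul_assoc, single_mul_single]

theorem spechtAction_one (μ : YoungDiagram) : spechtAction μ 1 = 1 := by
  ext1 x
  apply Subtype.ext
  exact one_mul (x : MonoidAlgebra ℚ (Perm (Fin μ.card)))

theorem irrChar_conj (μ : YoungDiagram) {π σ : Perm (Fin μ.card)} (h : IsConj π σ) :
    irrChar μ π = irrChar μ σ := by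
  obtain ⟨g, rfl⟩ := isConj_iff.mp h
  rw [irrChar_eq, irrChar_eq, spechtAction_mul, LinearMap.trace_mul_comm, ← spechtAction_mul]
  congr 2
  group

theorem irrChar_one (μ : YoungDiagram) :
    irrChar μ 1 = (Module.finrank ℚ (spechtModule μ) : ℚ) := by
  rw [irrChar_eq, spechtAction_one, LinearMap.trace_one]

theorem irrChar_one_ne_zero (μ : YoungDiagram) : irrChar μ 1 ≠ 0 := by
  rw [irrChar_one, Nat.cast_ne_zero]
  intro h
  have hbot := Submodule.finrank_eq_zero.mp h
  have hmem : youngSymmetrizer μ ∈ spechtModule μ := ⟨1, by simp⟩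
  rw [hbot, Submodule.mem_bot] at hmem
  have := youngSymmetrizer_coeff_one μ
  rw [hmem] at this
  simp at this

theorem sum_spechtAction_swap (μ : YoungDiagram) :
    ∑ p ∈ (Finset.univ : Finset (Fin μ.card)).offDiag, spechtAction μ (swap p.1 p.2) =
      doubleContent μ • 1 := by
  ext1 x
  apply Subtype.ext
  obtain ⟨_, y, rfl⟩ := x
  have h : transpositionSum μ.card * (y * youngSymmetrizer μ) =
      doubleContent μ • (y * youngSymmetrizer μ) := by
    rw [← mul_assoc, ← commute_transpositionSum, mul_assoc, transpositionSum_mul_youngSymmetrizer,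
      mul_smul_comm]
  rw [transpositionSum, Finset.sum_mul] at h
  simpa [LinearMap.sum_apply, spechtAction, LinearMap.restrict_apply] using h

theorem card_mul_irrChar_swap (μ : YoungDiagram) {x y : Fin μ.card} (hxy : x ≠ y) :
    (μ.card.descFactorial 2 : ℚ) * irrChar μ (swap x y) = doubleContent μ * irrChar μ 1 := by
  have h := congrArg (LinearMap.trace ℚ (spechtModule μ)) (sum_spechtAction_swap μ)
  rw [map_sum, map_smul, ← spechtAction_one, ← irrChar_eq, smul_eq_mul,
    Finset.sum_congr rfl (g := fun _ => irrChar μ (swap x y)), Finset.sum_const,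
    Finset.offDiag_card, Finset.card_univ, Fintype.card_fin, nsmul_eq_mul] at h
  · rw [← h]
    congr 2
    simp [Nat.descFactorial_succ, mul_comm, Nat.mul_sub]
  · intro p hp
    exact irrChar_conj μ (Perm.isConj_swap (by simpa using hp) hxy)

theorem finRotate_two_viaEmbedding {n : ℕ} (ι : Fin 2 ↪ Fin n) :
    (finRotate 2).viaEmbedding ι = swap (ι 0) (ι 1) := by
  ext1 x
  by_cases hx : x ∈ Set.range ι
  · obtain ⟨i, rfl⟩ := hx
    rw [Perm.viaEmbedding_apply]
    fin_cases i <;> simp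
  · rw [Perm.viaEmbedding_apply_of_notMem _ _ _ hx, swap_apply_of_ne_of_ne]
    · rintro rfl; exact hx ⟨0, rfl⟩
    · rintro rfl; exact hx ⟨1, rfl⟩

theorem sigmaCycle_two (μ : YoungDiagram) : SigmaCycle μ 2 = doubleContent μ := by
  unfold SigmaCycle normChar
  split_ifs with h
  · rw [finRotate_two_viaEmbedding, card_mul_irrChar_swap, mul_div_assoc,
      div_self (irrChar_one_ne_zero μ), mul_one]
    exact (Fin.castLEEmb h).injective.ne (by decide)
  · have hcard : μ.cells.card ≤ 1 := by
      have : μ.card < 2 := not_le.mp h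
      change μ.cells.card < 2 at this
      omega
    refine (Finset.sum_eq_zero fun c hc => Finset.sum_eq_zero fun d hd => ?_).symm
    rw [Finset.card_le_one.mp hcard c hc d hd]
    simp

theorem mem_dilate (μ : YoungDiagram) {s : ℕ} (hs : 0 < s) (c : ℕ × ℕ) :
    c ∈ (dilate μ s).cells ↔ (c.1 / s, c.2 / s) ∈ μ.cells := by
  simp only [dilate, Finset.mem_filter, Finset.mem_product, Finset.mem_range,
    and_iff_right_iff_imp]
  intro h
  have h1 : (c.1 / s, 0) ∈ μ := μ.isLowerSet (Prod.mk_le_mk.mpr ⟨le_rfl, Nat.zero_le _⟩) h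
  have h2 : (0, c.2 / s) ∈ μ := μ.isLowerSet (Prod.mk_le_mk.mpr ⟨Nat.zero_le _, le_rfl⟩) h
  rw [YoungDiagram.mem_iff_lt_colLen, Nat.div_lt_iff_lt_mul hs, mul_comm] at h1
  rw [YoungDiagram.mem_iff_lt_rowLen, Nat.div_lt_iff_lt_mul hs, mul_comm] at h2
  exact ⟨h1, h2⟩

theorem sum_dilate (μ : YoungDiagram) {s : ℕ} (hs : 0 < s) (f : ℕ × ℕ → ℚ) :
    ∑ c ∈ (dilate μ s).cells, f c =
      ∑ c ∈ μ.cells, ∑ a ∈ Finset.range s, ∑ b ∈ Finset.range s,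
        f (s * c.1 + a, s * c.2 + b) := by
  simp only [← Finset.sum_product']
  symm
  refine Finset.sum_bij' (fun p _ => (s * p.1.1 + p.2.1, s * p.1.2 + p.2.2))
    (fun c _ => ((c.1 / s, c.2 / s), (c.1 % s, c.2 % s))) ?_ ?_ ?_ ?_ ?_
  · rintro ⟨⟨i, j⟩, a, b⟩ h
    simp only [Finset.mem_product, Finset.mem_range] at h
    rw [mem_dilate μ hs]
    simpa [Nat.mul_add_div hs, Nat.div_eq_of_lt h.2.1, Nat.div_eq_of_lt h.2.2] using h.1
  · intro c hc
    rw [mem_dilate μ hs] at hc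
    simpa [Nat.mod_lt _ hs] using hc
  · rintro ⟨⟨i, j⟩, a, b⟩ h
    simp only [Finset.mem_product, Finset.mem_range] at h
    simp [Nat.mul_add_div hs, Nat.div_eq_of_lt h.2.1, Nat.div_eq_of_lt h.2.2,
      Nat.mod_eq_of_lt h.2.1, Nat.mod_eq_of_lt h.2.2]
  · intro c _
    simp [Nat.div_add_mod]
  · intros; rfl

theorem mul_add_eq_mul_add_iff {s i j a b : ℕ} (ha : a < s) (hb : b < s) :
    s * i + a = s * j + b ↔ i = j ∧ a = b := by
  constructor
  · intro h
    have hs : 0 < s := by omega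
    have h1 := congrArg (· / s) h
    have h2 := congrArg (· % s) h
    simp only [Nat.mul_add_div hs, Nat.div_eq_of_lt ha, Nat.div_eq_of_lt hb, Nat.mul_add_mod,
      Nat.mod_eq_of_lt ha, Nat.mod_eq_of_lt hb] at h1 h2
    exact ⟨h1, h2⟩
  · rintro ⟨rfl, rfl⟩; rfl

theorem sum_range_ite_mul_add_eq (s i j : ℕ) {a : ℕ} (ha : a < s) :
    ∑ b ∈ Finset.range s, (if s * i + a = s * j + b then (1 : ℚ) else 0) =
      if i = j then 1 else 0 := by
  rw [Finset.sum_congr rfl (g := fun b => if a = b then (if i = j then (1 : ℚ) else 0) else 0)]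
  · simp [ha]
  · intro b hb
    simp only [mul_add_eq_mul_add_iff ha (Finset.mem_range.mp hb)]
    split_ifs <;> simp_all

theorem doubleContent_dilate (μ : YoungDiagram) {s : ℕ} (hs : 0 < s) :
    doubleContent (dilate μ s) = doubleContent μ * (s : ℚ) ^ 3 := by
  unfold doubleContent
  simp only [sum_dilate μ hs, Finset.sum_mul]
  refine Finset.sum_congr rfl fun c _ => ?_
  have inner : ∀ a ∈ Finset.range s, ∀ b ∈ Finset.range s,
      ∑ d ∈ μ.cells, ∑ a' ∈ Finset.range s, ∑ b' ∈ Finset.range s,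
        ((if s * c.1 + a = s * d.1 + a' then (1 : ℚ) else 0) -
          (if s * c.2 + b = s * d.2 + b' then 1 else 0)) =
      ∑ d ∈ μ.cells, ((if c.1 = d.1 then 1 else 0) - (if c.2 = d.2 then 1 else 0)) * (s : ℚ) := by
    intro a ha b hb
    refine Finset.sum_congr rfl fun d _ => ?_
    simp only [Finset.sum_sub_distrib, sum_range_ite_mul_add_eq s _ _ (Finset.mem_range.mp hb),
      Finset.sum_const, Finset.card_range, nsmul_eq_mul, ← Finset.mul_sum,
      sum_range_ite_mul_add_eq s _ _ (Finset.mem_range.mp ha)]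
    ring
  rw [Finset.sum_congr rfl fun a ha => Finset.sum_congr rfl fun b hb => inner a ha b hb]
  simp only [Finset.sum_const, Finset.card_range, nsmul_eq_mul, Finset.mul_sum]
  exact Finset.sum_congr rfl fun d _ => by ring

theorem polynomial_eq_of_eval_pos_nat {p q : Polynomial ℚ}
    (h : ∀ s : ℕ, 0 < s → p.eval (s : ℚ) = q.eval (s : ℚ)) : p = q := by
  refine Polynomial.eq_of_infinite_eval_eq p q ?_
  refine Set.Infinite.mono ?_ (Set.infinite_range_of_injective
    (f := fun n : ℕ => ((n + 1 : ℕ) : ℚ)) fun a b hab => by simpa using hab)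
  rintro _ ⟨n, rfl⟩
  exact h (n + 1) n.succ_pos

/-- For every Young diagram `μ`, `Σ_2^μ = R_3^μ` (the Kerov polynomial `K_2` is `R_3`). -/
theorem kerov_K2 (μ : YoungDiagram) :
    SigmaCycle μ 2 = freeCumulant μ 3 := by
  have hX : ∀ s : ℕ, 0 < s → SigmaCycle (dilate μ s) (3 - 1) =
      (Polynomial.C (doubleContent μ) * Polynomial.X ^ 3).eval (s : ℚ) := by
    intro s hs
    rw [show 3 - 1 = 2 from rfl, sigmaCycle_two, doubleContent_dilate μ hs]
    simp
  have hex : ∃ p : Polynomial ℚ, ∀ s : ℕ, 0 < s →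
      SigmaCycle (dilate μ s) (3 - 1) = Polynomial.eval (s : ℚ) p := ⟨_, hX⟩
  rw [freeCumulant, dif_pos hex, sigmaCycle_two,
    polynomial_eq_of_eval_pos_nat fun s hs => (hex.choose_spec s hs).symm.trans (hX s hs)]
  simp

end AsympRep
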